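/- Let K be a field of characteristic zero, S = K[x_1,x_2,x_3,x_4], and let q_1,…,q_6 ∈ S be K-linearly independent quadrics. Then the K-vector space of linear syzygies {(l_1,…,l_6) ∈ (S_1)^6 : Σ_{i=1}^6 l_iq_i = 0} has dimension at most 9. -/

import Mathlib

open MvPolynomial

/-- Nonzero polynomials with pairwise distinct leading exponents are independent. -/
theorem aux_li {K : Type*} [Field K] (o : MonomialOrder (Fin 4)) {ι : Type*} [Fintype ι]
    (g : ι → MvPolynomial (Fin 4) K) (h0 : ∀ i, g i ≠ 0)
    (hinj : Function.Injective fun i => o.degree (g i)) : LinearIndependent K g := by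
  classical
  rw [Fintype.linearIndependent_iff]
  intro c hc
  by_contra! hne
  obtain ⟨i0, hi0⟩ := hne
  obtain ⟨i, hi, hmax⟩ := Finset.exists_max_image (Finset.univ.filter fun i => c i ≠ 0)
    (fun i => o.toSyn (o.degree (g i))) ⟨i0, by simpa using hi0⟩
  have hci : c i ≠ 0 := by simpa using hi
  have h := congrArg (coeff (o.degree (g i))) hc
  rw [coeff_sum, Finset.sum_eq_single i] at h
  · rw [coeff_smul, smul_eq_mul, coeff_zero] at h
    rcases mul_eq_zero.1 h with h | h
    · exact hci h
    · exact h0 i (o.leadingCoeff_eq_zero_iff.1 h)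
  · intro j _ hj
    rw [coeff_smul, smul_eq_mul]
    by_cases hcj : c j = 0
    · simp [hcj]
    · rw [o.coeff_eq_zero_of_lt, mul_zero]
      refine lt_of_le_of_ne (hmax j (by simpa using hcj)) fun he => hj (hinj ?_)
      exact o.toSyn.injective he
  · simp

/-- weights coding monomials as numbers -/
def auxW : Fin 4 → ℕ := ![1, 4, 16, 64]

/-- the code of an exponent -/
def auxCode (a : Fin 4 →₀ ℕ) : ℕ := a 0 + 4 * a 1 + 16 * a 2 + 64 * a 3

/-- codes of the quadratic monomials -/
def auxQ : Finset ℕ := {2, 8, 32, 128, 5, 17, 65, 20, 68, 80}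

/-- Macaulay's bound for six quadratic monomials in four variables. -/
theorem aux_comb : ∀ s ∈ auxQ.powersetCard 6,
    15 ≤ ((s ×ˢ (Finset.univ : Finset (Fin 4))).image fun p => auxW p.2 + p.1).card := by
  decide +kernel

theorem aux_code_single (i : Fin 4) (a : Fin 4 →₀ ℕ) :
    auxCode (Finsupp.single i 1 + a) = auxW i + auxCode a := by
  fin_cases i <;> simp [auxCode, auxW] <;> ring

theorem aux_code_mem (a : Fin 4 →₀ ℕ) (h : a 0 + a 1 + a 2 + a 3 = 2) : auxCode a ∈ auxQ := by
  simp only [auxCode, auxQ, Finset.mem_insert, Finset.mem_singleton]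
  omega

theorem aux_code_inj (a b : Fin 4 →₀ ℕ) (h : a 0 + a 1 + a 2 + a 3 = 2)
    (h' : b 0 + b 1 + b 2 + b 3 = 2) (hab : auxCode a = auxCode b) : a = b := by
  simp only [auxCode] at hab
  have e3 : a 3 = b 3 := by omega
  have e2 : a 2 = b 2 := by omega
  have e1 : a 1 = b 1 := by omega
  have e0 : a 0 = b 0 := by omega
  ext i
  fin_cases i <;> assumption

theorem aux_supp {K : Type*} [Field K] (o : MonomialOrder (Fin 4)) (f : MvPolynomial (Fin 4) K)
    (hf : f.IsHomogeneous 2) (h0 : f ≠ 0) :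
    o.degree f 0 + o.degree f 1 + o.degree f 2 + o.degree f 3 = 2 := by
  have h : coeff (o.degree f) f ≠ 0 := fun h => h0 (o.leadingCoeff_eq_zero_iff.1 h)
  have h2 := hf h
  rw [Pi.one_def, ← Finsupp.degree_eq_weight_one, Finsupp.degree_eq_sum, Fin.sum_univ_four] at h2
  exact h2

theorem aux_lin {K : Type*} [Field K] (f : MvPolynomial (Fin 4) K) (hf : f.IsHomogeneous 1) :
    ∑ j, coeff (Finsupp.single j 1) f • (X j : MvPolynomial (Fin 4) K) = f := by
  classical
  ext d
  rw [coeff_sum]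
  simp only [coeff_smul, smul_eq_mul, coeff_X]
  by_cases hd : ∃ j, Finsupp.single j 1 = d
  · obtain ⟨j, rfl⟩ := hd
    rw [Finset.sum_eq_single j]
    · simp
    · intro b _ hb
      rw [if_neg, mul_zero]
      intro h
      exact hb (Finsupp.single_left_injective one_ne_zero h)
    · simp
  · push Not at hd
    rw [Finset.sum_eq_zero fun j _ => by rw [if_neg (hd j), mul_zero]]
    by_contra hne
    have h2 := hf (Ne.symm hne)
    rw [Pi.one_def, ← Finsupp.degree_eq_weight_one] at h2
    rw [Finsupp.degree_eq_sum, Fin.sum_univ_four] at h2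
    have hj : d 0 = 1 ∨ d 1 = 1 ∨ d 2 = 1 ∨ d 3 = 1 := by omega
    rcases hj with h | h | h | h
    · refine hd 0 (Finsupp.ext fun i => ?_)
      fin_cases i <;> simp <;> omega
    · refine hd 1 (Finsupp.ext fun i => ?_)
      fin_cases i <;> simp <;> omega
    · refine hd 2 (Finsupp.ext fun i => ?_)
      fin_cases i <;> simp <;> omega
    · refine hd 3 (Finsupp.ext fun i => ?_)
      fin_cases i <;> simp <;> omega

theorem aux_rank (K : Type*) [Field K] (q : Fin 6 → MvPolynomial (Fin 4) K)
    (hq : ∀ i, (q i).IsHomogeneous 2) (hqind : LinearIndependent K q) :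
    15 ≤ Module.finrank K (LinearMap.range (Fintype.linearCombination K
      (fun p : Fin 6 × Fin 4 => X p.2 * q p.1))) := by
  classical
  let o : MonomialOrder (Fin 4) := MonomialOrder.lex
  set R := LinearMap.range (Fintype.linearCombination K
      (fun p : Fin 6 × Fin 4 => X p.2 * q p.1)) with hR
  set W := Submodule.span K (Set.range q) with hW
  have hWhom : ∀ f ∈ W, f.IsHomogeneous 2 := by
    intro f hf
    have : W ≤ homogeneousSubmodule (Fin 4) K 2 := by
      rw [hW, Submodule.span_le]
      rintro _ ⟨i, rfl⟩
      exact hq i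
    exact this hf
  have hWR : ∀ f ∈ W, ∀ j, X j * f ∈ R := by
    intro f hf j
    have : W ≤ R.comap (LinearMap.mulLeft K (X j)) := by
      rw [hW, Submodule.span_le]
      rintro _ ⟨i, rfl⟩
      change X j * q i ∈ R
      rw [hR, Fintype.range_linearCombination]
      exact Submodule.subset_span ⟨(i, j), rfl⟩
    exact this hf
  have hWfin : Module.finrank K W = 6 := by
    rw [hW, finrank_span_eq_card hqind]; simp
  let D : Finset ℕ := auxQ.filter fun t => ∃ f ∈ W, f ≠ 0 ∧ auxCode (o.degree f) = t
  have hD : ∀ t ∈ D, ∃ f ∈ W, f ≠ 0 ∧ auxCode (o.degree f) = t := fun t ht =>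
    (Finset.mem_filter.1 ht).2
  choose! F hFW hF0 hFt using hD
  have hD6 : 6 ≤ D.card := by
    let L : W →ₗ[K] (D → K) := LinearMap.pi fun t =>
      (lcoeff K (o.degree (F t))).comp W.subtype
    have hL : Function.Injective L := by
      rw [← LinearMap.ker_eq_bot, LinearMap.ker_eq_bot']
      rintro ⟨f, hf⟩ h
      by_contra hne
      have hf0 : f ≠ 0 := fun h => hne (Subtype.ext h)
      have ht : auxCode (o.degree f) ∈ D := Finset.mem_filter.2
        ⟨aux_code_mem _ (aux_supp o f (hWhom f hf) hf0), f, hf, hf0, rfl⟩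
      have he := aux_code_inj _ _ (aux_supp o _ (hWhom _ (hFW _ ht)) (hF0 _ ht))
        (aux_supp o f (hWhom f hf) hf0) (hFt _ ht)
      have h1 : coeff (o.degree (F (auxCode (o.degree f)))) f = 0 := congrFun h ⟨_, ht⟩
      rw [he] at h1
      exact hf0 (o.leadingCoeff_eq_zero_iff.1 h1)
    have := LinearMap.finrank_le_finrank_of_injective hL
    rw [hWfin] at this
    simpa using this
  obtain ⟨s, hsD, hs6⟩ := Finset.exists_subset_card_eq hD6
  have hcomb := aux_comb s (Finset.mem_powersetCard.2
    ⟨hsD.trans (Finset.filter_subset _ _), hs6⟩)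
  set T := (s ×ˢ (Finset.univ : Finset (Fin 4))).image fun p => auxW p.2 + p.1 with hT
  have hg : ∀ t : T, ∃ g : R, (g : MvPolynomial (Fin 4) K) ≠ 0 ∧
      auxCode (o.degree (g : MvPolynomial (Fin 4) K)) = t := by
    rintro ⟨t, ht⟩
    obtain ⟨⟨d, j⟩, hp, rfl⟩ := Finset.mem_image.1 ht
    have hd : d ∈ D := hsD (Finset.mem_product.1 hp).1
    refine ⟨⟨X j * F d, hWR _ (hFW d hd) j⟩, mul_ne_zero (X_ne_zero j) (hF0 d hd), ?_⟩
    change auxCode (o.degree (X j * F d)) = _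
    rw [o.degree_mul (X_ne_zero j) (hF0 d hd), o.degree_X, aux_code_single, hFt d hd]
  choose g hg0 hgt using hg
  have hli : LinearIndependent K (fun t : T => (g t : MvPolynomial (Fin 4) K)) := by
    refine aux_li o _ hg0 fun a b hab => Subtype.ext ?_
    rw [← hgt a, ← hgt b]
    exact congrArg auxCode hab
  have hli2 : LinearIndependent K g := LinearIndependent.of_comp R.subtype hli
  have := hli2.fintype_card_le_finrank
  rw [Fintype.card_coe] at this
  omega

/-- for 6 linearly independent quadrics in `S = K[x₁,…,x₄]`
(`char K = 0`), the space of linear syzygies has dimension at most 9: every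
linearly independent family of linear syzygies has at most 9 members. -/
theorem stmt11 (K : Type*) [Field K] [CharZero K]
    (q : Fin 6 → MvPolynomial (Fin 4) K)
    (hq : ∀ i, (q i).IsHomogeneous 2) (hqind : LinearIndependent K q)
    (m : ℕ) (V : Fin m → (Fin 6 → MvPolynomial (Fin 4) K))
    (hVhom : ∀ k i, (V k i).IsHomogeneous 1)
    (hVsyz : ∀ k, ∑ i, V k i * q i = 0)
    (hVind : LinearIndependent K V) :
    m ≤ 9 := by
  classical
  have hr := aux_rank K q hq hqind
  set Φ := Fintype.linearCombination K
      (fun p : Fin 6 × Fin 4 => X p.2 * q p.1) with hΦ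
  have hrn := LinearMap.finrank_range_add_finrank_ker Φ
  simp only [Module.finrank_fintype_fun_eq_card, Fintype.card_prod, Fintype.card_fin] at hrn
  let b : (Fin 6 × Fin 4 → K) →ₗ[K] (Fin 6 → MvPolynomial (Fin 4) K) :=
    LinearMap.pi fun i => ∑ j, (LinearMap.proj (i, j)).smulRight (X j)
  let c : Fin m → (Fin 6 × Fin 4 → K) := fun k p => coeff (Finsupp.single p.2 1) (V k p.1)
  have hbc : ∀ k, b (c k) = V k := by
    intro k
    funext i
    simpa [b, c] using aux_lin (V k i) (hVhom k i)
  have hker : ∀ k, c k ∈ LinearMap.ker Φ := by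
    intro k
    rw [LinearMap.mem_ker, ← hVsyz k, hΦ, Fintype.linearCombination_apply,
      Fintype.sum_prod_type]
    refine Finset.sum_congr rfl fun i _ => ?_
    conv_rhs => rw [← aux_lin (V k i) (hVhom k i), Finset.sum_mul]
    refine Finset.sum_congr rfl fun j _ => ?_
    simp [c]
  have hli : LinearIndependent K (fun k => (⟨c k, hker k⟩ : LinearMap.ker Φ)) := by
    refine LinearIndependent.of_comp (b ∘ₗ (LinearMap.ker Φ).subtype) ?_
    convert hVind using 1
    funext k
    exact hbc k
  have := hli.fintype_card_le_finrank
  rw [Fintype.card_fin] at this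
  omega
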